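/- arXiv:math/0408175 — 7 statements merged into one kernel-verified Lean document; each statement's English description precedes it below -/
import Mathlib

section
/- Let C and σ be n×n complex matrices with C² = I and σ² = I such that C − σ is invertible, and let t be a nonzero complex number. Then the matrix A_σ(t) := (1/2)(I − C) + (t/2)(I − σ) is invertible, with inverse A_σ(t)⁻¹ = (2/t)·(C − σ)⁻²·(I + C) + 2·(C − σ)⁻²·(I + σ). -/
/-- For involutions `C` and `σ`, the matrix `(2/t)(I + C) + 2(I + σ)` times `A_σ(t)` is
`(C − σ)²`. -/
theorem mul_interpolation_eq_sub_sq {R : Type*} [Ring R] [Algebra ℂ R] {C σ : R}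
    (hC : C * C = 1) (hσ : σ * σ = 1) {t : ℂ} (ht : t ≠ 0) :
    ((2 / t) • (1 + C) + (2 : ℂ) • (1 + σ)) * ((1 / 2 : ℂ) • (1 - C) + (t / 2) • (1 - σ)) =
      (C - σ) ^ 2 := by
  have hC' : (1 + C) * (1 - C) = 0 := by
    rw [← (Commute.one_left C).mul_self_sub_mul_self_eq, hC, one_mul, sub_self]
  have hσ' : (1 + σ) * (1 - σ) = 0 := by
    rw [← (Commute.one_left σ).mul_self_sub_mul_self_eq, hσ, one_mul, sub_self]
  have hone : 2 / t * (t / 2) = 1 := by field_simp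
  have hone' : (2 : ℂ) * (1 / 2) = 1 := by norm_num
  simp only [add_mul _ _ (_ + _), mul_add ((_ : ℂ) • _), smul_mul_smul_comm, hC', hσ', hone, hone',
    smul_zero, one_smul, zero_add, add_zero]
  simp only [sq, sub_mul, mul_sub, add_mul, one_mul, mul_one, hC, hσ]
  abel

/-- The interpolating matrix `A_σ(t) = (1/2)(I − C) + (t/2)(I − σ)` is invertible for `t ≠ 0`,
with inverse `(2/t)·(C − σ)⁻²·(I + C) + 2·(C − σ)⁻²·(I + σ)`. -/
theorem stmt_6 {n : ℕ} (C σ : Matrix (Fin n) (Fin n) ℂ)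
    (hC : C * C = 1) (hσ : σ * σ = 1) (h : IsUnit (C - σ)) (t : ℂ) (ht : t ≠ 0) :
    IsUnit ((1 / 2 : ℂ) • (1 - C) + (t / 2) • (1 - σ)) ∧
    ((1 / 2 : ℂ) • (1 - C) + (t / 2) • (1 - σ))⁻¹ =
      (2 / t) • (((C - σ)⁻¹) ^ 2 * (1 + C)) + (2 : ℂ) • (((C - σ)⁻¹) ^ 2 * (1 + σ)) := by
  have hdet : IsUnit (C - σ).det := (Matrix.isUnit_iff_isUnit_det _).mp h
  have hinv : ((2 / t) • (((C - σ)⁻¹) ^ 2 * (1 + C)) + (2 : ℂ) • (((C - σ)⁻¹) ^ 2 * (1 + σ))) *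
      ((1 / 2 : ℂ) • (1 - C) + (t / 2) • (1 - σ)) = 1 := by
    rw [← mul_smul_comm, ← mul_smul_comm, ← mul_add, mul_assoc,
      mul_interpolation_eq_sub_sq hC hσ ht, sq, sq, mul_assoc,
      Matrix.nonsing_inv_mul_cancel_left _ _ hdet, Matrix.nonsing_inv_mul _ hdet]
  exact ⟨.of_mul_eq_one_right _ hinv, Matrix.inv_eq_left_inv hinv⟩
end

section
/- Let C, σ₁, σ₂ be n×n complex matrices with C² = I, σ₁² = I, σ₂² = I such that C − σ₂ is invertible, and let t be a nonzero complex number. Set A_{σᵢ}(t) := (1/2)(I − C) + (t/2)(I − σᵢ). Then A_{σ₁}(t)·A_{σ₂}(t)⁻¹ = I + (σ₂ − σ₁)·(C − σ₂)⁻²·(C + I) + t·(I − σ₁)·(C − σ₂)⁻²·(I + σ₂). -/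
/-- The square of the difference of two involutions commutes with the second one. -/
theorem commute_sub_sq_right_of_mul_self_eq_one {R : Type*} [Ring R] {c s : R}
    (hc : c * c = 1) (hs : s * s = 1) : Commute s ((c - s) ^ 2) := by
  have hsq : (c - s) ^ 2 = 2 - c * s - s * c := by
    rw [sq, sub_mul, mul_sub, mul_sub, hc, hs, ← one_add_one_eq_two]
    abel
  have hl : s * (s * c) = c := by rw [← mul_assoc, hs, one_mul]
  have hr : c * s * s = c := by rw [mul_assoc, hs, mul_one]
  rw [Commute, SemiconjBy, hsq, mul_sub, mul_sub, sub_mul, sub_mul, hl, hr, mul_two, two_mul,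
    mul_assoc s c s]
  abel

/-- The square of the difference of two involutions commutes with the first one. -/
theorem commute_sub_sq_left_of_mul_self_eq_one {R : Type*} [Ring R] {c s : R}
    (hc : c * c = 1) (hs : s * s = 1) : Commute c ((c - s) ^ 2) := by
  rw [← neg_sub s c, neg_sq]
  exact commute_sub_sq_right_of_mul_self_eq_one hs hc

/-- An explicit right inverse of `(1 - C) / 2 + t (1 - S) / 2` for involutions `C` and `S` with
invertible difference. -/
theorem half_smul_one_sub_add_half_smul_one_sub_mul_eq_one {m : Type*} [Fintype m] [DecidableEq m]
    {C S : Matrix m m ℂ} (hC : C * C = 1) (hS : S * S = 1) (h : IsUnit (C - S))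
    {t : ℂ} (ht : t ≠ 0) :
    ((1 / 2 : ℂ) • (1 - C) + (t / 2) • (1 - S)) *
      (((2 / t) • (1 + C) + (2 : ℂ) • (1 + S)) * ((C - S)⁻¹) ^ 2) = 1 := by
  have hdet : IsUnit (C - S).det := (Matrix.isUnit_iff_isUnit_det _).mp h
  have hinv : (C - S) ^ 2 * ((C - S)⁻¹) ^ 2 = 1 := by
    rw [sq, sq, mul_assoc, Matrix.mul_nonsing_inv_cancel_left _ _ hdet,
      Matrix.mul_nonsing_inv _ hdet]
  have hCC : (1 - C) * (1 + C) = 0 := by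
    rw [sub_mul, mul_add, mul_add, hC]; simp [add_comm]
  have hSS : (1 - S) * (1 + S) = 0 := by
    rw [sub_mul, mul_add, mul_add, hS]; simp [add_comm]
  have hcross : (1 - C) * (1 + S) + (1 - S) * (1 + C) = (C - S) ^ 2 := by
    simp only [sq, sub_mul, mul_sub, mul_add, mul_one, one_mul, hC, hS]
    abel
  have hprod : ((1 / 2 : ℂ) • (1 - C) + (t / 2) • (1 - S)) *
      ((2 / t) • (1 + C) + (2 : ℂ) • (1 + S)) = (C - S) ^ 2 := by
    rw [add_mul, mul_add, mul_add]
    simp only [smul_mul_smul_comm, hCC, hSS, smul_zero, zero_add, add_zero]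
    rw [← hcross, show (1 / 2 : ℂ) * 2 = 1 by norm_num, show t / 2 * (2 / t) = 1 by field_simp,
      one_smul, one_smul]
  rw [← mul_assoc, hprod, hinv]


/-- Equation (4.16):
`A_{σ₁}(t)·A_{σ₂}(t)⁻¹ = I + (σ₂ − σ₁)(C − σ₂)⁻²(C + I) + t(I − σ₁)(C − σ₂)⁻²(I + σ₂)`. -/
theorem stmt_7 {n : ℕ} (C σ₁ σ₂ : Matrix (Fin n) (Fin n) ℂ)
    (hC : C * C = 1) (h1 : σ₁ * σ₁ = 1) (h2 : σ₂ * σ₂ = 1)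
    (h : IsUnit (C - σ₂)) (t : ℂ) (ht : t ≠ 0) :
    ((1 / 2 : ℂ) • (1 - C) + (t / 2) • (1 - σ₁)) *
      ((1 / 2 : ℂ) • (1 - C) + (t / 2) • (1 - σ₂))⁻¹ =
    1 + (σ₂ - σ₁) * ((C - σ₂)⁻¹) ^ 2 * (C + 1) +
      t • ((1 - σ₁) * ((C - σ₂)⁻¹) ^ 2 * (1 + σ₂)) := by
  have hcommC : Commute C (((C - σ₂)⁻¹) ^ 2) := by
    rw [Matrix.inv_pow', ← Matrix.zpow_neg_one]
    exact Matrix.Commute.zpow_right (commute_sub_sq_left_of_mul_self_eq_one hC h2) _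
  have hcommS : Commute σ₂ (((C - σ₂)⁻¹) ^ 2) := by
    rw [Matrix.inv_pow', ← Matrix.zpow_neg_one]
    exact Matrix.Commute.zpow_right (commute_sub_sq_right_of_mul_self_eq_one hC h2) _
  have hright := half_smul_one_sub_add_half_smul_one_sub_mul_eq_one hC h2 h ht
  have hsplit : (1 / 2 : ℂ) • (1 - C) + (t / 2) • (1 - σ₁) =
      ((1 / 2 : ℂ) • (1 - C) + (t / 2) • (1 - σ₂)) + (t / 2) • (σ₂ - σ₁) := by
    module
  have hproj : (1 - σ₁) * (1 + σ₂) = (σ₂ - σ₁) * (1 + σ₂) := by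
    simp only [sub_mul, mul_add, mul_one, one_mul, h2]
    abel
  have hC' := ((Commute.one_left _).add_left hcommC).eq
  have hS' := ((Commute.one_left _).add_left hcommS).eq
  rw [Matrix.inv_eq_right_inv hright, hsplit, add_mul, hright, add_comm C 1, mul_assoc, mul_assoc,
    ← hC', ← hS', ← mul_assoc (1 - σ₁), hproj, mul_assoc (σ₂ - σ₁), add_assoc, add_mul,
    smul_mul_assoc, smul_mul_assoc, smul_mul_assoc, mul_add, mul_smul_comm, mul_smul_comm,
    smul_add, smul_smul, smul_smul, show t / 2 * (2 / t) = 1 by field_simp,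
    div_mul_cancel₀ t two_ne_zero, one_smul]
end

section
/- Let C and σ be n×n complex matrices with C² = I and σ² = I such that C − σ is invertible, and let t be a complex number with t ≠ 0 and t ≠ 1. Then the matrix t·I + (C − σ)⁻¹·(I − C) is invertible, with inverse (1/(t−1))·I − (1/(t(t−1)))·(I + C)·(C − σ)⁻¹. -/
/-- For `t ≠ 0, 1`, the matrix `t·I + (C − σ)⁻¹(I − C)` is invertible, with inverse
`(1/(t−1))·I − (1/(t(t−1)))·(I + C)(C − σ)⁻¹`. -/
theorem stmt_8 {n : ℕ} (C σ : Matrix (Fin n) (Fin n) ℂ)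
    (hC : C * C = 1) (hσ : σ * σ = 1) (h : IsUnit (C - σ))
    (t : ℂ) (ht0 : t ≠ 0) (ht1 : t ≠ 1) :
    IsUnit (t • (1 : Matrix (Fin n) (Fin n) ℂ) + (C - σ)⁻¹ * (1 - C)) ∧
    (t • (1 : Matrix (Fin n) (Fin n) ℂ) + (C - σ)⁻¹ * (1 - C))⁻¹ =
      (1 / (t - 1)) • (1 : Matrix (Fin n) (Fin n) ℂ) -
        (1 / (t * (t - 1))) • ((1 + C) * (C - σ)⁻¹) := by
  have hdet := (Matrix.isUnit_iff_isUnit_det _).1 h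
  have hDE := Matrix.mul_nonsing_inv _ hdet
  have hED := Matrix.nonsing_inv_mul _ hdet
  generalize (C - σ)⁻¹ = E at hDE hED ⊢
  have hanti : C * (C - σ) = -((C - σ) * σ) := by
    rw [mul_sub, sub_mul, hC, hσ]
    abel
  have hEC : E * C = -(σ * E) := by
    calc E * C = E * (C * (C - σ)) * E := by
          rw [mul_assoc, mul_assoc, hDE, mul_one]
      _ = -(E * (C - σ) * σ * E) := by rw [hanti]; noncomm_ring
      _ = -(σ * E) := by rw [hED, one_mul]
  have hAB : E * (1 - C) * ((1 + C) * E) = 0 := by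
    have hproj : (1 - C) * (1 + C) = 0 := by
      rw [sub_mul, mul_add, one_mul, mul_add, hC, mul_one, one_mul]
      abel
    rw [mul_assoc, ← mul_assoc (1 - C), hproj, zero_mul, mul_zero]
  have hA : E * (1 - C) = (1 + C) * E - 1 := by
    calc E * (1 - C) = (1 + C) * E - (C - σ) * E := by
          rw [mul_sub, hEC]
          noncomm_ring
      _ = (1 + C) * E - 1 := by rw [hDE]
  have ht1' : t - 1 ≠ 0 := sub_ne_zero.2 ht1
  have hinv : (t • (1 : Matrix (Fin n) (Fin n) ℂ) + E * (1 - C)) *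
      ((1 / (t - 1)) • (1 : Matrix (Fin n) (Fin n) ℂ) -
        (1 / (t * (t - 1))) • ((1 + C) * E)) = 1 := by
    generalize E * (1 - C) = A at hAB hA ⊢
    generalize (1 + C) * E = B at hAB hA ⊢
    simp only [add_mul, smul_mul_assoc, one_mul, mul_sub A, mul_smul_comm, mul_one, hAB]
    rw [hA]
    match_scalars <;> field_simp <;> ring
  exact ⟨IsUnit.of_mul_eq_one _ hinv, Matrix.inv_eq_right_inv hinv⟩
end

section
/- Let C, σ₁, σ₂ be n×n complex matrices with C² = I, σ₁² = I, σ₂² = I such that C − σ₁ and C − σ₂ are invertible, and set β := (C − σ₂)⁻¹·(C − σ₁)⁻¹·(I − σ₁)·(I + σ₂). Then σ₂·β = −β and β·σ₂ = β; consequently β² = 0 and det(I + β) = 1. -/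
/-- The inverse of a difference of two involutions intertwines them up to sign. -/
theorem mul_inv_sub_involution {m R : Type*} [Fintype m] [DecidableEq m] [CommRing R]
    {C σ : Matrix m m R} (hC : C * C = 1) (hσ : σ * σ = 1) (hu : IsUnit (C - σ)) :
    C * (C - σ)⁻¹ = -((C - σ)⁻¹ * σ) := by
  have hdet := (Matrix.isUnit_iff_isUnit_det _).1 hu
  have hcomm : (C - σ) * C = -(σ * (C - σ)) := by
    rw [sub_mul, mul_sub, hC, hσ, neg_sub]
  apply hu.mul_left_cancel
  rw [← mul_assoc, hcomm, neg_mul, mul_assoc, mul_neg, ← mul_assoc (C - σ),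
    Matrix.mul_nonsing_inv _ hdet, mul_one, one_mul]

/-- The inverse of a difference of two involutions intertwines them up to sign. -/
theorem involution_mul_inv_sub {m R : Type*} [Fintype m] [DecidableEq m] [CommRing R]
    {C σ : Matrix m m R} (hC : C * C = 1) (hσ : σ * σ = 1) (hu : IsUnit (C - σ)) :
    σ * (C - σ)⁻¹ = -((C - σ)⁻¹ * C) := by
  have hdet := (Matrix.isUnit_iff_isUnit_det _).1 hu
  have hcomm : (C - σ) * σ = -(C * (C - σ)) := by
    rw [sub_mul, mul_sub, hC, hσ, neg_sub]
  apply hu.mul_left_cancel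
  rw [← mul_assoc, hcomm, neg_mul, mul_assoc, mul_neg, ← mul_assoc (C - σ),
    Matrix.mul_nonsing_inv _ hdet, mul_one, one_mul]

/-- Equations (4.19)-(4.20): for `β = (C − σ₂)⁻¹(C − σ₁)⁻¹(I − σ₁)(I + σ₂)` one has
`σ₂β = −β`, `βσ₂ = β`, hence `β² = 0` and `det(I + β) = 1`. -/
theorem stmt_9 {n : ℕ} (C σ₁ σ₂ : Matrix (Fin n) (Fin n) ℂ)
    (hC : C * C = 1) (h1 : σ₁ * σ₁ = 1) (h2 : σ₂ * σ₂ = 1)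
    (hu1 : IsUnit (C - σ₁)) (hu2 : IsUnit (C - σ₂)) :
    σ₂ * ((C - σ₂)⁻¹ * (C - σ₁)⁻¹ * (1 - σ₁) * (1 + σ₂)) =
      -((C - σ₂)⁻¹ * (C - σ₁)⁻¹ * (1 - σ₁) * (1 + σ₂)) ∧
    ((C - σ₂)⁻¹ * (C - σ₁)⁻¹ * (1 - σ₁) * (1 + σ₂)) * σ₂ =
      (C - σ₂)⁻¹ * (C - σ₁)⁻¹ * (1 - σ₁) * (1 + σ₂) ∧
    ((C - σ₂)⁻¹ * (C - σ₁)⁻¹ * (1 - σ₁) * (1 + σ₂)) ^ 2 = 0 ∧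
    (1 + (C - σ₂)⁻¹ * (C - σ₁)⁻¹ * (1 - σ₁) * (1 + σ₂)).det = 1 := by
  have hX : σ₂ * ((C - σ₂)⁻¹ * (C - σ₁)⁻¹ * (1 - σ₁)) =
      -((C - σ₂)⁻¹ * (C - σ₁)⁻¹ * (1 - σ₁)) := by
    calc σ₂ * ((C - σ₂)⁻¹ * (C - σ₁)⁻¹ * (1 - σ₁))
        = σ₂ * (C - σ₂)⁻¹ * (C - σ₁)⁻¹ * (1 - σ₁) := by simp only [mul_assoc]
      _ = -((C - σ₂)⁻¹ * (C * (C - σ₁)⁻¹) * (1 - σ₁)) := by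
        rw [involution_mul_inv_sub hC h2 hu2]; simp only [mul_assoc, neg_mul]
      _ = (C - σ₂)⁻¹ * (C - σ₁)⁻¹ * (σ₁ * (1 - σ₁)) := by
        rw [mul_inv_sub_involution hC h1 hu1]
        simp only [mul_assoc, neg_mul, mul_neg, neg_neg]
      _ = -((C - σ₂)⁻¹ * (C - σ₁)⁻¹ * (1 - σ₁)) := by
        rw [mul_sub, h1, mul_one, ← neg_sub 1 σ₁, mul_neg]
  generalize (C - σ₂)⁻¹ * (C - σ₁)⁻¹ * (1 - σ₁) = X at hX ⊢
  have hzero : (1 + σ₂) * X = 0 := by rw [add_mul, hX, one_mul, add_neg_cancel]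
  refine ⟨?_, ?_, ?_, ?_⟩
  · rw [← mul_assoc, hX, neg_mul]
  · rw [mul_assoc, add_mul, h2, one_mul, add_comm σ₂]
  · rw [sq, mul_assoc, ← mul_assoc (1 + σ₂), hzero, zero_mul, mul_zero]
  · rw [Matrix.det_one_add_mul_comm, hzero, add_zero, Matrix.det_one]
end

section
/- Let C, σ₁, σ₂ be n×n complex matrices with C² = I, σ₁² = I, σ₂² = I such that C − σ₁ and C − σ₂ are invertible. Then det( (I + C)·(C − σ₂)⁻¹ − (C − σ₁)⁻¹·(I − C) ) = 1. -/
/-- If `C` and `σ` are involutions, the inverse `E` of `C - σ` satisfies `C * E + E * C = 1`. -/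
theorem mul_add_mul_eq_one_of_inverse_sub {R : Type*} [Ring R] {C σ E : R}
    (hC : C * C = 1) (hσ : σ * σ = 1) (hl : E * (C - σ) = 1) (hr : (C - σ) * E = 1) :
    C * E + E * C = 1 := by
  have hD : C * (C - σ) + (C - σ) * C = (C - σ) * (C - σ) := by
    simp only [mul_sub, sub_mul, hC, hσ]
    abel
  calc C * E + E * C = E * (C - σ) * C * E + E * C * ((C - σ) * E) := by
        rw [hl, hr, one_mul, mul_one]
    _ = E * (C * (C - σ) + (C - σ) * C) * E := by noncomm_ring
    _ = E * (C - σ) * ((C - σ) * E) := by rw [hD]; noncomm_ring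
    _ = 1 := by rw [hl, hr, one_mul]

theorem one_add_mul_mul_one_sub {R : Type*} [Ring R] {C E : R}
    (hC : C * C = 1) (hE : C * E + E * C = 1) :
    (1 + C) * E * (1 - C) = 2 * ((1 + C) * E) - (1 + C) ∧
      (1 + C) * E * (1 - C) = 2 * (E * (1 - C)) + (1 - C) := by
  have hEC : E * C = 1 - C * E := eq_sub_of_add_eq' hE
  have hCEC : C * (C * E) = E := by rw [← mul_assoc, hC, one_mul]
  constructor <;>
  · rw [two_mul]
    simp only [mul_sub, add_mul, mul_one, one_mul, mul_assoc, hEC, hCEC]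
    abel

/-- The determinant arising in equation (4.18) equals 1:
`det((I + C)(C − σ₂)⁻¹ − (C − σ₁)⁻¹(I − C)) = 1`. -/
theorem stmt_10 {n : ℕ} (C σ₁ σ₂ : Matrix (Fin n) (Fin n) ℂ)
    (hC : C * C = 1) (h1 : σ₁ * σ₁ = 1) (h2 : σ₂ * σ₂ = 1)
    (hu1 : IsUnit (C - σ₁)) (hu2 : IsUnit (C - σ₂)) :
    ((1 + C) * (C - σ₂)⁻¹ - (C - σ₁)⁻¹ * (1 - C)).det = 1 := by
  rw [Matrix.isUnit_iff_isUnit_det] at hu1 hu2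
  have hE₁ := mul_add_mul_eq_one_of_inverse_sub hC h1 (Matrix.nonsing_inv_mul _ hu1)
    (Matrix.mul_nonsing_inv _ hu1)
  have hE₂ := mul_add_mul_eq_one_of_inverse_sub hC h2 (Matrix.nonsing_inv_mul _ hu2)
    (Matrix.mul_nonsing_inv _ hu2)
  generalize (C - σ₁)⁻¹ = E₁ at *
  generalize (C - σ₂)⁻¹ = E₂ at *
  have key : (1 + C) * E₂ - E₁ * (1 - C) =
      1 + ((1 + C) * ((2⁻¹ : ℂ) • (E₂ - E₁))) * (1 - C) := by
    have hdouble : (2 : ℂ) • ((1 + C) * E₂ - E₁ * (1 - C)) =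
        (2 : ℂ) • 1 + (1 + C) * (E₂ - E₁) * (1 - C) := by
      rw [mul_sub (1 + C), sub_mul _ _ (1 - C), (one_add_mul_mul_one_sub hC hE₂).1,
        (one_add_mul_mul_one_sub hC hE₁).2]
      simp only [two_smul, two_mul]
      abel
    rw [Matrix.mul_smul, Matrix.smul_mul, eq_sub_of_add_eq' hdouble.symm, smul_sub,
      inv_smul_smul₀ two_ne_zero, inv_smul_smul₀ two_ne_zero]
    abel
  have hzero : (1 - C) * (1 + C) = 0 := by
    simp [sub_mul, mul_add, hC]
  rw [key, Matrix.det_one_add_mul_comm, ← mul_assoc, hzero, zero_mul, add_zero, Matrix.det_one]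
end

section
/- Let C, σ₁, σ₂ be n×n complex matrices with C² = I, σ₁² = I, σ₂² = I such that C − σ₁ and C − σ₂ are invertible. Then, as the real parameter t tends to 0 through nonzero values (equivalently through t ∈ (0,1)), the ratio det( (1/2)(I − C) + (t/2)(I − σ₁) ) / det( (1/2)(I − C) + (t/2)(I − σ₂) ) converges to det(C − σ₁)/det(C − σ₂); here the denominator is nonzero for every t ≠ 0. -/
open Matrix in
/-- If `P` and `Q` are idempotents with `Q - P` invertible, then `P + t Q` and `(t (1 - P) - P) (Q - P)`
have the same determinant. -/
theorem det_idempotent_add_smul {ι R : Type*} [Fintype ι] [DecidableEq ι] [CommRing R]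
    {P Q : Matrix ι ι R} (hP : P * P = P) (hQ : Q * Q = Q) (hu : IsUnit (Q - P)) (t : R) :
    (P + t • Q).det = (t • (1 - P) - P).det * (Q - P).det := by
  obtain ⟨D', hDD', hD'D⟩ := isUnit_iff_exists.mp hu
  -- `E` is the projection onto the range of `P` along the range of `Q`.
  obtain ⟨E, hE⟩ : ∃ E, E = -(P * D') := ⟨_, rfl⟩
  have hED : E * (Q - P) = -P := by rw [hE, neg_mul, mul_assoc, hD'D, mul_one]
  have hPE : P * E = E := by rw [hE, mul_neg, ← mul_assoc, hP]
  have hEP : E * P = P := by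
    have hcomm : P * (Q - P) = (Q - P) * (1 - Q) := by
      simp only [mul_sub, sub_mul, mul_one, hP, hQ]; abel
    have hD'P : D' * P = (1 - Q) * D' := by
      calc D' * P = D' * (P * (Q - P)) * D' := by simp only [mul_assoc, hDD', mul_one]
        _ = (1 - Q) * D' := by rw [hcomm, ← mul_assoc, hD'D, one_mul]
    have hPQ : P * (1 - Q) = -(P * (Q - P)) := by
      simp only [mul_sub, mul_one, hP]; abel
    rw [hE, neg_mul, mul_assoc, hD'P, ← mul_assoc, hPQ, neg_mul, neg_neg, mul_assoc, hDD', mul_one]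
  have hEE : E * E = E := by
    calc E * E = E * (P * E) := by rw [hPE]
      _ = E := by rw [← mul_assoc, hEP, hPE]
  have hfactor : P + t • Q = (t • (1 - E) - E) * (Q - P) := by
    rw [sub_mul, smul_mul_assoc, sub_mul, one_mul, hED, sub_neg_eq_add, sub_neg_eq_add,
      sub_add_cancel, add_comm]
  have hinv : (1 + (E - P)) * (1 - (E - P)) = 1 := by
    simp only [add_mul, mul_sub, sub_mul, mul_one, one_mul, hP, hEE, hPE, hEP]; abel
  have hconj : (1 + (E - P)) * (t • (1 - E) - E) * (1 - (E - P)) = t • (1 - P) - P := by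
    have hswap : (1 + (E - P)) * (t • (1 - E) - E) = (t • (1 - P) - P) * (1 + (E - P)) := by
      simp only [mul_add, add_mul, mul_sub, sub_mul, mul_one, one_mul, smul_mul_assoc,
        mul_smul_comm, smul_sub, smul_add, hP, hEE, hPE]
      abel
    rw [hswap, mul_assoc, hinv, mul_one]
  have hdet : (t • (1 - E) - E).det = (t • (1 - P) - P).det := by
    have hone := congrArg det hinv
    rw [det_mul, det_one] at hone
    rw [← hconj, det_mul, det_mul, mul_right_comm, hone, one_mul]
  rw [hfactor, det_mul, hdet]

open Matrix in
theorem det_smul_one_sub_idempotent_ne_zero {ι K : Type*} [Fintype ι] [DecidableEq ι] [Field K]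
    {P : Matrix ι ι K} (hP : P * P = P) {t : K} (ht : t ≠ 0) : (t • (1 - P) - P).det ≠ 0 := by
  have hinv : (t • (1 - P) - P) * (t⁻¹ • (1 - P) - P) = 1 := by
    simp only [mul_sub, sub_mul, mul_one, one_mul, smul_mul_assoc, mul_smul_comm, smul_sub,
      smul_smul, hP, inv_mul_cancel₀ ht, one_smul]
    abel
  exact det_ne_zero_of_right_inverse hinv

/-- If `A` is an involution, then `(1 - A) / 2` is idempotent. -/
theorem idempotent_half_one_sub {ι K : Type*} [Fintype ι] [DecidableEq ι] [Field K]
    [NeZero (2 : K)] {A : Matrix ι ι K} (hA : A * A = 1) :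
    ((1 / 2 : K) • (1 - A)) * ((1 / 2 : K) • (1 - A)) = (1 / 2 : K) • (1 - A) := by
  have hsq : (1 - A) * (1 - A) = (2 : K) • (1 - A) := by
    simp only [mul_sub, sub_mul, mul_one, one_mul, hA, two_smul]; abel
  rw [smul_mul_smul_comm, hsq, smul_smul, mul_assoc, one_div_mul_cancel (NeZero.ne 2), mul_one]

/-- The determinant of the pencil `(1 - C) / 2 + t (1 - σ) / 2` of two involutions depends on `σ` only
through the factor `det (C - σ)`. -/
theorem det_involution_pencil {ι K : Type*} [Fintype ι] [DecidableEq ι] [Field K] [NeZero (2 : K)]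
    {C σ : Matrix ι ι K} (hC : C * C = 1) (hσ : σ * σ = 1) (hu : IsUnit (C - σ)) (t : K) :
    ((1 / 2 : K) • (1 - C) + (t / 2) • (1 - σ)).det =
      (t • (1 - (1 / 2 : K) • (1 - C)) - (1 / 2 : K) • (1 - C)).det * (1 / 2 : K) ^ Fintype.card ι *
        (C - σ).det := by
  have hdiff : (1 / 2 : K) • (1 - σ) - (1 / 2 : K) • (1 - C) = (1 / 2 : K) • (C - σ) := by
    rw [← smul_sub]; congr 1; abel
  have hunit : IsUnit ((1 / 2 : K) • (1 - σ) - (1 / 2 : K) • (1 - C)) := by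
    rw [hdiff, Matrix.isUnit_iff_isUnit_det, Matrix.det_smul]
    exact ((IsUnit.mk0 _ (one_div_ne_zero (NeZero.ne 2))).pow _).mul
      ((Matrix.isUnit_iff_isUnit_det _).mp hu)
  have key := det_idempotent_add_smul (idempotent_half_one_sub hC) (idempotent_half_one_sub hσ)
    hunit t
  rw [hdiff, Matrix.det_smul, smul_smul, mul_one_div, ← mul_assoc] at key
  exact key

/-- Equations (4.17)-(4.21): as `t → 0` through nonzero values, the ratio
`det((1/2)(I − C) + (t/2)(I − σ₁)) / det((1/2)(I − C) + (t/2)(I − σ₂))`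
converges to `det(C − σ₁)/det(C − σ₂)`, the denominator being nonzero for `t ≠ 0`. -/
theorem stmt_11 {n : ℕ} (C σ₁ σ₂ : Matrix (Fin n) (Fin n) ℂ)
    (hC : C * C = 1) (h1 : σ₁ * σ₁ = 1) (h2 : σ₂ * σ₂ = 1)
    (hu1 : IsUnit (C - σ₁)) (hu2 : IsUnit (C - σ₂)) :
    (∀ t : ℝ, t ≠ 0 →
      ((1 / 2 : ℂ) • (1 - C) + ((t : ℂ) / 2) • (1 - σ₂)).det ≠ 0) ∧
    Filter.Tendsto
      (fun t : ℝ =>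
        ((1 / 2 : ℂ) • (1 - C) + ((t : ℂ) / 2) • (1 - σ₁)).det /
          ((1 / 2 : ℂ) • (1 - C) + ((t : ℂ) / 2) • (1 - σ₂)).det)
      (nhdsWithin 0 {(0 : ℝ)}ᶜ)
      (nhds ((C - σ₁).det / (C - σ₂).det)) := by
  have hpre : ∀ t : ℝ, t ≠ 0 → ((t : ℂ) • (1 - (1 / 2 : ℂ) • (1 - C)) -
      (1 / 2 : ℂ) • (1 - C)).det * (1 / 2 : ℂ) ^ Fintype.card (Fin n) ≠ 0 := fun t ht =>
    mul_ne_zero (det_smul_one_sub_idempotent_ne_zero (idempotent_half_one_sub hC)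
      (Complex.ofReal_ne_zero.mpr ht)) (pow_ne_zero _ (by norm_num))
  refine ⟨fun t ht => ?_, ?_⟩
  · rw [det_involution_pencil hC h2 hu2]
    exact mul_ne_zero (hpre t ht) ((Matrix.isUnit_iff_isUnit_det _).mp hu2).ne_zero
  · refine tendsto_const_nhds.congr' ?_
    filter_upwards [self_mem_nhdsWithin] with t ht
    rw [det_involution_pencil hC h1 hu1, det_involution_pencil hC h2 hu2,
      mul_div_mul_left _ _ (hpre t ht)]
end

section
/- For every real a with 0 < a < 1, the Hurwitz zeta function satisfies ζ(0, a) + ζ(0, 1 − a) = 0 and (d/ds)[ζ(s, a) + ζ(s, 1 − a)]|_{s=0} = −log(2·sin(πa)). -/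
open Complex Filter Topology Set MeasureTheory Asymptotics

lemma Complex.re_lt_one_of_norm_eq_one {z : ℂ} (hz : ‖z‖ = 1) (hz1 : z ≠ 1) : z.re < 1 := by
  refine lt_of_le_of_ne (hz ▸ z.re_le_norm) fun h ↦ hz1 ?_
  have h2 : z.re ^ 2 + z.im ^ 2 = 1 := by
    rw [← one_pow 2, ← hz, ← normSq_eq_norm_sq, normSq_apply]
    ring
  apply Complex.ext
  · simpa using h
  · rw [h] at h2
    simpa using h2

lemma Complex.re_one_sub_mul_exp_neg_pos {z : ℂ} (hz : ‖z‖ = 1) (hz1 : z ≠ 1) {t : ℝ}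
    (ht : 0 ≤ t) : 0 < (1 - z * cexp (-t)).re := by
  have h := re_lt_one_of_norm_eq_one hz hz1
  have he : Real.exp (-t) ≤ 1 := Real.exp_le_one_iff.mpr (by linarith)
  have he0 := Real.exp_pos (-t)
  rw [← ofReal_neg, ← ofReal_exp, sub_re, re_mul_ofReal, one_re]
  nlinarith

lemma Complex.one_sub_mul_exp_neg_ne_zero {z : ℂ} (hz : ‖z‖ = 1) (hz1 : z ≠ 1) {t : ℝ}
    (ht : 0 ≤ t) : 1 - z * cexp (-t) ≠ 0 := by
  intro h
  simpa [h] using re_one_sub_mul_exp_neg_pos hz hz1 ht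

lemma Complex.norm_exp_two_pi_mul_I_mul_ofReal (a : ℝ) : ‖cexp (2 * Real.pi * I * a)‖ = 1 := by
  simp [norm_exp]

/-- The generating function `∑ n ≥ 1, zⁿ exp (-n t)` whose Mellin transform is the
polylogarithm. -/
noncomputable def polylogKernel (z : ℂ) (t : ℝ) : ℂ := z * cexp (-t) / (1 - z * cexp (-t))

lemma tendsto_one_sub_mul_exp_neg (z : ℂ) :
    Tendsto (fun t : ℝ ↦ 1 - z * cexp (-t)) atTop (𝓝 1) := by
  have h : Tendsto (fun t : ℝ ↦ cexp (-t)) atTop (𝓝 0) := by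
    have := (continuous_ofReal.tendsto 0).comp Real.tendsto_exp_neg_atTop_nhds_zero
    simpa [Function.comp_def] using this
  simpa using (h.const_mul z).const_sub 1

lemma hasSum_polylogKernel {z : ℂ} (hz : ‖z‖ = 1) {t : ℝ} (ht : 0 < t) :
    HasSum (fun n : ℕ ↦ z ^ (n + 1) * Real.exp (-((n : ℝ) + 1) * t)) (polylogKernel z t) := by
  have hlt : ‖z * cexp (-t)‖ < 1 := by
    rw [norm_mul, hz, one_mul, ← ofReal_neg, norm_exp_ofReal]
    simpa using ht
  convert! (hasSum_geometric_of_norm_lt_one hlt).mul_left (z * cexp (-t)) using 2 with n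
  rw [← pow_succ', mul_pow, ← Complex.exp_nat_mul]
  push_cast
  ring_nf

lemma continuousOn_polylogKernel {z : ℂ} (hz : ‖z‖ = 1) (hz1 : z ≠ 1) :
    ContinuousOn (polylogKernel z) (Ici 0) := by
  unfold polylogKernel
  exact ContinuousOn.div (by fun_prop) (by fun_prop)
    fun t ht ↦ one_sub_mul_exp_neg_ne_zero hz hz1 ht

lemma isBigO_atTop_polylogKernel (z : ℂ) :
    polylogKernel z =O[atTop] fun t ↦ Real.exp (-1 * t) := by
  have h1 : (fun t : ℝ ↦ z / (1 - z * cexp (-t))) =O[atTop] fun _ ↦ (1 : ℝ) :=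
    ((tendsto_const_nhds (x := z)).div (tendsto_one_sub_mul_exp_neg z) one_ne_zero).isBigO_one ℝ
  have h2 : (fun t : ℝ ↦ cexp (-t)) =O[atTop] fun t ↦ Real.exp (-1 * t) :=
    IsBigO.of_norm_le fun t ↦ by rw [← ofReal_neg, norm_exp_ofReal, neg_one_mul]
  refine (h1.mul h2).congr (fun t ↦ ?_) (fun t ↦ one_mul _)
  rw [polylogKernel]
  ring

lemma isBigO_zero_polylogKernel {z : ℂ} (hz : ‖z‖ = 1) (hz1 : z ≠ 1) :
    polylogKernel z =O[𝓝[>] 0] fun t : ℝ ↦ t ^ (-(0 : ℝ)) := by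
  have h : Tendsto (polylogKernel z) (𝓝[>] 0) (𝓝 (polylogKernel z 0)) :=
    (continuousOn_polylogKernel hz hz1 0 self_mem_Ici).mono_left
      (nhdsWithin_mono _ Ioi_subset_Ici_self)
  simpa using h.isBigO_one ℝ

lemma locallyIntegrableOn_polylogKernel {z : ℂ} (hz : ‖z‖ = 1) (hz1 : z ≠ 1) :
    LocallyIntegrableOn (polylogKernel z) (Ioi 0) :=
  ((continuousOn_polylogKernel hz hz1).mono Ioi_subset_Ici_self).locallyIntegrableOn
    measurableSet_Ioi

lemma mellin_polylogKernel_one {z : ℂ} (hz : ‖z‖ = 1) (hz1 : z ≠ 1) :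
    mellin (polylogKernel z) 1 = -log (1 - z) := by
  have hint : IntegrableOn (polylogKernel z) (Ioi 0) := by
    simpa [MellinConvergent] using mellinConvergent_of_isBigO_rpow_exp (s := 1) one_pos
      (locallyIntegrableOn_polylogKernel hz hz1) (isBigO_atTop_polylogKernel z)
      (isBigO_zero_polylogKernel hz hz1) (by simp)
  have hderiv (t : ℝ) (ht : t ∈ Ici 0) :
      HasDerivAt (fun t : ℝ ↦ log (1 - z * cexp (-t))) (polylogKernel z t) t := by
    have h := ((((hasDerivAt_id t).ofReal_comp).neg.cexp).const_mul z).const_sub 1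
    convert! h.clog_real (Or.inl (re_one_sub_mul_exp_neg_pos hz hz1 ht)) using 1
    simp [polylogKernel]
  have htop : Tendsto (fun t : ℝ ↦ log (1 - z * cexp (-t))) atTop (𝓝 0) := by
    simpa using (tendsto_one_sub_mul_exp_neg z).clog one_mem_slitPlane
  simpa [mellin] using integral_Ioi_of_hasDerivAt_of_tendsto' hderiv hint htop

namespace HurwitzZeta

lemma mellin_polylogKernel_eq_Gamma_mul_expZeta (a : ℝ) {s : ℂ} (hs : 1 < s.re) :
    mellin (polylogKernel (cexp (2 * Real.pi * I * a))) s = Gamma s * expZeta a s := by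
  set z := cexp (2 * Real.pi * I * a) with hzdef
  have hz : ‖z‖ = 1 := norm_exp_two_pi_mul_I_mul_ofReal a
  have hsum : Summable fun n : ℕ ↦ ‖z ^ (n + 1)‖ / ((n : ℝ) + 1) ^ s.re := by
    simpa [hz] using (summable_nat_add_iff 1).mpr (Real.summable_one_div_nat_rpow.mpr hs)
  have hmellin := hasSum_mellin (a := fun n : ℕ ↦ z ^ (n + 1)) (p := fun n : ℕ ↦ (n : ℝ) + 1)
    (fun n ↦ Or.inr (by positivity)) (by linarith) (fun t ht ↦ hasSum_polylogKernel hz ht) hsum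
  have hzeta := (hasSum_nat_add_iff' 1).mpr (hasSum_expZeta_of_one_lt_re a hs)
  have hs0 : s ≠ 0 := ne_zero_of_one_lt_re hs
  rw [Finset.sum_range_one, Nat.cast_zero, zero_cpow hs0, div_zero, sub_zero] at hzeta
  refine hmellin.unique ?_
  convert! hzeta.mul_left (Gamma s) using 2 with n
  rw [hzdef, ← Complex.exp_nat_mul]
  push_cast
  rw [mul_div_assoc]
  ring_nf

lemma expZeta_one {a : ℝ} (ha : (a : UnitAddCircle) ≠ 0)
    (hz1 : cexp (2 * Real.pi * I * a) ≠ 1) :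
    expZeta a 1 = -log (1 - cexp (2 * Real.pi * I * a)) := by
  set z := cexp (2 * Real.pi * I * a) with hzdef
  have hz : ‖z‖ = 1 := norm_exp_two_pi_mul_I_mul_ofReal a
  have hM : ContinuousAt (mellin (polylogKernel z)) 1 :=
    (mellin_differentiableAt_of_isBigO_rpow_exp one_pos
      (locallyIntegrableOn_polylogKernel hz hz1) (isBigO_atTop_polylogKernel z)
      (isBigO_zero_polylogKernel hz hz1) (by simp)).continuousAt
  have hE : ContinuousAt (fun s ↦ Gamma s * expZeta a s) 1 :=
    (differentiableAt_Gamma_one.mul (differentiable_expZeta_of_ne_zero ha 1)).continuousAt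
  have hline : Tendsto (fun x : ℝ ↦ (x : ℂ)) (𝓝[>] 1) (𝓝 1) :=
    (continuous_ofReal.tendsto' 1 1 ofReal_one).mono_left nhdsWithin_le_nhds
  have heq : mellin (polylogKernel z) 1 = Gamma 1 * expZeta a 1 := by
    refine tendsto_nhds_unique (hM.tendsto.comp hline) ((hE.tendsto.comp hline).congr' ?_)
    filter_upwards [self_mem_nhdsWithin] with x hx
    exact (mellin_polylogKernel_eq_Gamma_mul_expZeta a (by simpa using hx)).symm
  rw [← mellin_polylogKernel_one hz hz1, heq, Gamma_one, one_mul]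

lemma coe_unitAddCircle_ne_zero {a : ℝ} (h0 : 0 < a) (h1 : a < 1) : (a : UnitAddCircle) ≠ 0 := by
  intro h
  rw [AddCircle.coe_eq_zero_iff_of_mem_Ico (p := (1 : ℝ)) ⟨h0.le, h1⟩] at h
  exact h0.ne' h

lemma cosZeta_one {a : ℝ} (h0 : 0 < a) (h1 : a < 1) :
    cosZeta a 1 = -(Real.log (2 * Real.sin (Real.pi * a)) : ℂ) := by
  have ha := coe_unitAddCircle_ne_zero h0 h1
  have hsin : 0 < Real.sin (Real.pi * a) :=
    Real.sin_pos_of_pos_of_lt_pi (by positivity) (by nlinarith [Real.pi_pos])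
  set z := cexp (2 * Real.pi * I * a) with hzdef
  have hnorm : ‖1 - z‖ = 2 * Real.sin (Real.pi * a) := by
    have := norm_exp_I_mul_ofReal_sub_one (2 * Real.pi * a)
    rw [norm_sub_rev, hzdef]
    convert! this using 1
    · push_cast
      ring_nf
    · rw [show 2 * Real.pi * a / 2 = Real.pi * a by ring, Real.norm_of_nonneg (by positivity)]
  have hz : ‖z‖ = 1 := norm_exp_two_pi_mul_I_mul_ofReal a
  have hz1 : z ≠ 1 := by
    intro h
    rw [h, sub_self, norm_zero] at hnorm
    linarith
  have hconj : cexp (2 * Real.pi * I * ((-a : ℝ) : ℂ)) = (starRingEnd ℂ) z := by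
    rw [hzdef, ← exp_conj]
    simp [conj_ofNat]
  have hconj1 : (starRingEnd ℂ) z ≠ 1 := by
    intro h
    exact hz1 (by simpa using congrArg (starRingEnd ℂ) h)
  have harg : (1 - z).arg ≠ Real.pi := by
    refine slitPlane_arg_ne_pi (Or.inl ?_)
    simpa using re_lt_one_of_norm_eq_one hz hz1
  have hneg : expZeta (-(a : UnitAddCircle)) 1 = -(starRingEnd ℂ) (log (1 - z)) := by
    have := expZeta_one (a := -a) (by simpa using ha) (by rwa [hconj])
    rw [hconj] at this
    rw [← log_conj _ harg, map_sub, map_one, ← this, AddCircle.coe_neg]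
  rw [cosZeta_eq, expZeta_one ha hz1, hneg, ← neg_add, add_conj, log_re, hnorm]
  push_cast
  ring

lemma hasDerivAt_hurwitzZetaEven_zero {a : UnitAddCircle} (ha : a ≠ 0) :
    HasDerivAt (hurwitzZetaEven a) (cosZeta a 1 / 2) 0 := by
  have hpi : (2 * Real.pi : ℂ) ≠ 0 := by simp [Real.pi_ne_zero]
  let g : ℂ → ℂ := fun s ↦ 2 * (2 * Real.pi : ℂ) ^ (-(1 - s)) * Gamma (1 - s) * cosZeta a (1 - s)
  have hsub : DifferentiableAt ℂ (fun s : ℂ ↦ 1 - s) 0 := by fun_prop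
  have hg : DifferentiableAt ℂ g 0 := by
    refine (((hsub.neg.const_cpow (Or.inl hpi)).const_mul 2).mul ?_).mul ?_
    · refine DifferentiableAt.comp (0 : ℂ) ?_ hsub
      simpa using differentiableAt_Gamma_one
    · exact (differentiable_cosZeta_of_ne_zero ha _).comp (0 : ℂ) hsub
  have hsin : HasDerivAt (fun s : ℂ ↦ sin (Real.pi * s / 2)) (Real.pi / 2 : ℂ) 0 := by
    have := (((hasDerivAt_id (0 : ℂ)).const_mul (Real.pi : ℂ)).div_const 2).csin
    simpa using this
  have hmul := hg.hasDerivAt.mul hsin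
  have hval : deriv g 0 * sin (Real.pi * 0 / 2) + g 0 * (Real.pi / 2 : ℂ) = cosZeta a 1 / 2 := by
    have hpi' : (Real.pi : ℂ) ≠ 0 := by simp [Real.pi_ne_zero]
    simp only [g, sub_zero, Gamma_one, cpow_neg_one, mul_zero, zero_div, sin_zero]
    field_simp
    ring
  rw [hval] at hmul
  refine hmul.congr_of_eventuallyEq ?_
  filter_upwards [Metric.ball_mem_nhds (0 : ℂ) one_pos] with s hs
  have hs1 : ‖s‖ < 1 := by simpa using hs
  have hre : s.re < 1 := (re_le_norm s).trans_lt hs1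
  have hne (n : ℕ) : 1 - s ≠ -n := by
    intro h
    have := congrArg re h
    simp only [sub_re, one_re, neg_re, natCast_re] at this
    have := n.cast_nonneg (α := ℝ)
    linarith
  have h := hurwitzZetaEven_one_sub a hne (Or.inl ha)
  rw [sub_sub_cancel, show (Real.pi : ℂ) * (1 - s) / 2 = Real.pi / 2 - Real.pi * s / 2 by ring,
    cos_pi_div_two_sub] at h
  rw [h]
  simp only [g, Pi.mul_apply]
  ring

lemma hurwitzZeta_add_hurwitzZeta_one_sub (a : ℝ) (s : ℂ) :
    hurwitzZeta (a : UnitAddCircle) s + hurwitzZeta ((1 - a : ℝ) : UnitAddCircle) s =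
      2 * hurwitzZetaEven a s := by
  have h : ((1 - a : ℝ) : UnitAddCircle) = -(a : UnitAddCircle) := by
    rw [AddCircle.coe_sub, AddCircle.coe_period, zero_sub]
  rw [h, hurwitzZetaEven_eq]
  ring

end HurwitzZeta


open HurwitzZeta in
/-- For `0 < a < 1`: `ζ(0, a) + ζ(0, 1 − a) = 0` and
`(d/ds)[ζ(s, a) + ζ(s, 1 − a)]|_{s=0} = −log(2 sin(πa))`. -/
theorem stmt_15 (a : ℝ) (h0 : 0 < a) (h1 : a < 1) :
    hurwitzZeta (a : UnitAddCircle) 0 + hurwitzZeta ((1 - a : ℝ) : UnitAddCircle) 0 = 0 ∧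
    deriv (fun s : ℂ =>
        hurwitzZeta (a : UnitAddCircle) s + hurwitzZeta ((1 - a : ℝ) : UnitAddCircle) s) 0 =
      -(Real.log (2 * Real.sin (Real.pi * a)) : ℂ) := by
  have ha := coe_unitAddCircle_ne_zero h0 h1
  simp only [hurwitzZeta_add_hurwitzZeta_one_sub]
  refine ⟨by rw [hurwitzZetaEven_apply_zero, if_neg ha, mul_zero], ?_⟩
  rw [((hasDerivAt_hurwitzZetaEven_zero ha).const_mul 2).deriv, ← cosZeta_one h0 h1]
  ring
end
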